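/- arXiv:1510.00954 — 2 statements merged into one kernel-verified Lean document; each statement's English description precedes it below -/
import Mathlib

section
/- Let r₀, β₀, β₁ be real numbers and ℓ, α positive real numbers. There exists a convex, strictly increasing C^∞ function h : [r₀, r₀+ℓ] → ℝ such that the piecewise function equal to β₀ for r ≤ r₀, to h(r) for r ∈ [r₀, r₀+ℓ], and to αr + β₁ for r ≥ r₀+ℓ is C^∞ on ℝ, if and only if α·r₀ < β₀ − β₁ and β₁ − β₀ + α·r₀ + α·ℓ > 0. -/
open intervalIntegral Set Filter Topology

/-- The smooth monotone step that rises from `0` at `c` to `1` at `c + δ`. -/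
noncomputable def smoothStep (c δ x : ℝ) : ℝ := Real.smoothTransition ((x - c) / δ)

namespace smoothStep

variable {c δ x : ℝ}

theorem contDiff : ContDiff ℝ (⊤ : ℕ∞) (smoothStep c δ) :=
  Real.smoothTransition.contDiff.comp ((contDiff_id.sub contDiff_const).div_const δ)

theorem continuous : Continuous (smoothStep c δ) := contDiff.continuous

theorem monotone (hδ : 0 < δ) : Monotone (smoothStep c δ) := fun x y h =>
  Real.smoothTransition.monotone (by gcongr)

theorem eq_zero (hδ : 0 < δ) (hx : x ≤ c) : smoothStep c δ x = 0 :=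
  Real.smoothTransition.zero_of_nonpos (div_nonpos_of_nonpos_of_nonneg (by linarith) hδ.le)

theorem eq_one (hδ : 0 < δ) (hx : c + δ ≤ x) : smoothStep c δ x = 1 :=
  Real.smoothTransition.one_of_one_le ((one_le_div hδ).2 (by linarith))

theorem pos (hδ : 0 < δ) (hx : c < x) : 0 < smoothStep c δ x :=
  Real.smoothTransition.pos_of_pos (div_pos (by linarith) hδ)

theorem nonneg : 0 ≤ smoothStep c δ x := Real.smoothTransition.nonneg _

theorem le_one : smoothStep c δ x ≤ 1 := Real.smoothTransition.le_one _

theorem integral_le {a b : ℝ} (hδ : 0 < δ) (ha : a ≤ c) (hb : c ≤ b) :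
    ∫ x in a..b, smoothStep c δ x ≤ b - c := by
  have hint : ∀ p q, IntervalIntegrable (smoothStep c δ) MeasureTheory.volume p q :=
    fun p q => continuous.intervalIntegrable p q
  have hleft : ∫ x in a..c, smoothStep c δ x = 0 := by
    rw [integral_congr (g := fun _ => (0 : ℝ))]
    · simp
    · intro x hx
      rw [uIcc_of_le ha] at hx
      exact eq_zero hδ hx.2
  have hright : ∫ x in c..b, smoothStep c δ x ≤ ∫ _ in c..b, (1 : ℝ) :=
    integral_mono_on hb (hint c b) intervalIntegrable_const fun _ _ => le_one
  rw [← integral_add_adjacent_intervals (hint a c) (hint c b), hleft, zero_add]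
  simpa using hright

theorem le_integral {a b : ℝ} (hδ : 0 < δ) (ha : a ≤ c) (hb : c + δ ≤ b) :
    b - (c + δ) ≤ ∫ x in a..b, smoothStep c δ x := by
  have hint : ∀ p q, IntervalIntegrable (smoothStep c δ) MeasureTheory.volume p q :=
    fun p q => continuous.intervalIntegrable p q
  have hleft : 0 ≤ ∫ x in a..(c + δ), smoothStep c δ x :=
    integral_nonneg (by linarith) fun _ _ => nonneg
  have hright : ∫ _ in (c + δ)..b, (1 : ℝ) ≤ ∫ x in (c + δ)..b, smoothStep c δ x :=
    integral_mono_on hb intervalIntegrable_const (hint _ b) fun _ hx => (eq_one hδ hx.1).ge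
  rw [← integral_add_adjacent_intervals (hint a (c + δ)) (hint (c + δ) b)]
  rw [integral_const, smul_eq_mul, mul_one] at hright
  linarith

end smoothStep

/-- A smooth monotone step from `0` to `1` across `[a, b]` can have any prescribed integral
strictly between `0` and `b - a`. -/
theorem exists_monotone_step_integral_eq {a b J : ℝ} (hJ : 0 < J) (hJb : J < b - a) :
    ∃ φ : ℝ → ℝ, ContDiff ℝ (⊤ : ℕ∞) φ ∧ Monotone φ ∧ (∀ x ≤ a, φ x = 0) ∧
      (∀ x, b ≤ x → φ x = 1) ∧ (∀ x, a < x → 0 < φ x) ∧ ∫ x in a..b, φ x = J := by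
  obtain ⟨δ, hδ, hδm⟩ := exists_between (lt_min hJ (sub_pos.2 hJb))
  obtain ⟨hδJ, hδb⟩ := lt_min_iff.1 hδm
  have hA : ∫ x in a..b, smoothStep (b - δ) δ x ≤ b - (b - δ) :=
    smoothStep.integral_le hδ (by linarith) (by linarith)
  have hB : b - (a + δ) ≤ ∫ x in a..b, smoothStep a δ x :=
    smoothStep.le_integral hδ le_rfl (by linarith)
  set A := ∫ x in a..b, smoothStep (b - δ) δ x with hAdef
  set B := ∫ x in a..b, smoothStep a δ x with hBdef
  have hAB : 0 < B - A := by linarith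
  set t := (J - A) / (B - A) with ht
  have ht0 : 0 < t := div_pos (by linarith) hAB
  have ht1 : 0 < 1 - t := sub_pos.2 ((div_lt_one hAB).2 (by linarith))
  refine ⟨fun x => (1 - t) * smoothStep (b - δ) δ x + t * smoothStep a δ x,
    (contDiff_const.mul smoothStep.contDiff).add (contDiff_const.mul smoothStep.contDiff),
    ((smoothStep.monotone hδ).const_mul ht1.le).add ((smoothStep.monotone hδ).const_mul ht0.le),
    fun x hx => ?_, fun x hx => ?_, fun x hx => ?_, ?_⟩
  · simp only [smoothStep.eq_zero hδ hx,
      smoothStep.eq_zero hδ (show x ≤ b - δ by linarith), mul_zero, add_zero]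
  · simp only [smoothStep.eq_one hδ (show a + δ ≤ x by linarith),
      smoothStep.eq_one hδ (show b - δ + δ ≤ x by linarith)]
    ring
  · exact add_pos_of_nonneg_of_pos (mul_nonneg ht1.le smoothStep.nonneg)
      (mul_pos ht0 (smoothStep.pos hδ hx))
  · rw [integral_add ((smoothStep.continuous.const_mul _).intervalIntegrable _ _)
      ((smoothStep.continuous.const_mul _).intervalIntegrable _ _), integral_const_mul,
      integral_const_mul, ← hAdef, ← hBdef, ht]
    field_simp
    ring

/-- A convex function on `[a, b]` with zero slope at `a` and slope `m > 0` at `b` lies strictly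
above its tangent line at `b` when evaluated at `a`. -/
theorem ConvexOn.tangent_lt_of_deriv_zero {g : ℝ → ℝ} {a b m : ℝ} (hab : a < b) (hm : 0 < m)
    (hg : ConvexOn ℝ (Icc a b) g) (ha : HasDerivAt g 0 a) (hb : HasDerivAt g m b) :
    g b - m * (b - a) < g a := by
  have hev : ∀ᶠ x in 𝓝[>] a, slope g a x < m :=
    (ha.tendsto_slope.mono_left (nhdsWithin_mono a fun x hx => ne_of_gt hx)).eventually_lt_const hm
  obtain ⟨x, hxm, hax, hxb⟩ := (hev.and (Ioo_mem_nhdsGT hab)).exists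
  have hslope := hg.slope_le_of_hasDerivAt ⟨hax.le, hxb.le⟩ (right_mem_Icc.2 hab.le) hxb hb
  rw [slope_def_field, div_lt_iff₀ (sub_pos.2 hax)] at hxm
  rw [slope_def_field, div_le_iff₀ (sub_pos.2 hxb)] at hslope
  linarith


/-- Lemma A.1: existence of a convex, strictly increasing smooth interpolation
between the constant `β₀` and the affine function `α·r + β₁` iff the slope
inequalities hold. -/
theorem stmt_0 (r₀ β₀ β₁ ℓ α : ℝ) (hℓ : 0 < ℓ) (hα : 0 < α) :
    (∃ g : ℝ → ℝ, ContDiff ℝ (⊤ : ℕ∞) g ∧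
      (∀ r ≤ r₀, g r = β₀) ∧
      (∀ r, r₀ + ℓ ≤ r → g r = α * r + β₁) ∧
      ConvexOn ℝ (Set.Icc r₀ (r₀ + ℓ)) g ∧
      StrictMonoOn g (Set.Icc r₀ (r₀ + ℓ)))
    ↔ (α * r₀ < β₀ - β₁ ∧ 0 < β₁ - β₀ + α * r₀ + α * ℓ) := by
  constructor
  · rintro ⟨g, hg, hleft, hright, hconv, hmono⟩
    have hlt : r₀ < r₀ + ℓ := by linarith
    have hd : Differentiable ℝ g := hg.differentiable (by simp)
    have hga := hleft r₀ le_rfl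
    have hgb := hright (r₀ + ℓ) le_rfl
    have ha : HasDerivAt g 0 r₀ := by
      have h := ((hasDerivWithinAt_const r₀ (Iic r₀) β₀).congr hleft hga)
      rw [← (uniqueDiffWithinAt_Iic r₀).eq_deriv _ (hd r₀).hasDerivAt.hasDerivWithinAt h]
      exact (hd r₀).hasDerivAt
    have hb : HasDerivAt g α (r₀ + ℓ) := by
      have h := ((((hasDerivAt_id (r₀ + ℓ)).const_mul α).add_const β₁).hasDerivWithinAt
        (s := Ici (r₀ + ℓ))).congr hright hgb
      rw [mul_one] at h
      rw [← (uniqueDiffWithinAt_Ici (r₀ + ℓ)).eq_deriv _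
        (hd (r₀ + ℓ)).hasDerivAt.hasDerivWithinAt h]
      exact (hd (r₀ + ℓ)).hasDerivAt
    have htan := hconv.tangent_lt_of_deriv_zero hlt hα ha hb
    have hinc := hmono (left_mem_Icc.2 hlt.le) (right_mem_Icc.2 hlt.le) hlt
    rw [hga, hgb] at htan hinc
    constructor <;> linarith
  · rintro ⟨h₁, h₂⟩
    obtain ⟨φ, hφ, hφm, hφ0, hφ1, hφpos, hφint⟩ :=
      exists_monotone_step_integral_eq (a := r₀) (b := r₀ + ℓ)
        (J := (β₁ - β₀ + α * r₀ + α * ℓ) / α) (div_pos h₂ hα)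
        (by rw [div_lt_iff₀ hα]; linarith)
    have hint : ∀ p q, IntervalIntegrable φ MeasureTheory.volume p q :=
      fun p q => hφ.continuous.intervalIntegrable p q
    have hd : ∀ x, HasDerivAt (fun r => β₀ + α * ∫ x in r₀..r, φ x) (α * φ x) x := fun x =>
      ((hφ.continuous.integral_hasStrictDerivAt r₀ x).hasDerivAt.const_mul α).const_add β₀
    have hdiff : Differentiable ℝ fun r => β₀ + α * ∫ x in r₀..r, φ x :=
      fun x => (hd x).differentiableAt
    have hderiv : deriv (fun r => β₀ + α * ∫ x in r₀..r, φ x) = fun x => α * φ x :=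
      funext fun x => (hd x).deriv
    refine ⟨fun r => β₀ + α * ∫ x in r₀..r, φ x, ?_, fun r hr => ?_, fun r hr => ?_, ?_, ?_⟩
    · rw [contDiff_infty_iff_deriv, hderiv]
      exact ⟨hdiff, contDiff_const.mul hφ⟩
    · have h : ∫ x in r₀..r, φ x = 0 := by
        rw [integral_congr (g := fun _ => (0 : ℝ))]
        · simp
        · intro x hx
          rw [uIcc_of_ge hr] at hx
          exact hφ0 x hx.2
      simp [h]
    · have h : ∫ x in (r₀ + ℓ)..r, φ x = r - (r₀ + ℓ) := by
        rw [integral_congr (g := fun _ => (1 : ℝ))]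
        · simp
        · intro x hx
          rw [uIcc_of_le hr] at hx
          exact hφ1 x hx.1
      simp only [← integral_add_adjacent_intervals (hint r₀ (r₀ + ℓ)) (hint (r₀ + ℓ) r), h, hφint]
      field_simp
      ring
    · refine (Monotone.convexOn_univ_of_deriv hdiff ?_).subset (subset_univ _) (convex_Icc _ _)
      rw [hderiv]
      exact hφm.const_mul hα.le
    · refine strictMonoOn_of_deriv_pos (convex_Icc _ _) hdiff.continuous.continuousOn
        fun x hx => ?_
      rw [interior_Icc] at hx
      rw [hderiv]
      exact mul_pos hα (hφpos x hx.1)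
end

section
/- Let r₀, β₀, β₁ be real numbers and ℓ, α positive real numbers. There exists a concave, strictly increasing C^∞ function h : [r₀, r₀+ℓ] → ℝ such that the piecewise function equal to αr + β₀ for r ≤ r₀, to h(r) for r ∈ [r₀, r₀+ℓ], and to β₁ for r ≥ r₀+ℓ is C^∞ on ℝ, if and only if 0 < β₁ − β₀ − α·r₀ < ℓ·α. -/
open Filter Topology

namespace Real.smoothTransition

theorem tendsto_integral_pow_zero :
    Tendsto (fun n : ℕ ↦ ∫ t in (0 : ℝ)..1, smoothTransition t ^ n) atTop (𝓝 0) := by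
  have h := intervalIntegral.tendsto_integral_filter_of_dominated_convergence
    (μ := MeasureTheory.volume) (a := (0 : ℝ)) (b := 1) (l := atTop)
    (F := fun (n : ℕ) t ↦ smoothTransition t ^ n) (f := fun _ ↦ 0) (fun _ ↦ 1)
    (Eventually.of_forall fun n ↦
      (smoothTransition.continuous.pow n).aestronglyMeasurable)
    (Eventually.of_forall fun n ↦ Eventually.of_forall fun t _ ↦ by
      rw [Real.norm_eq_abs, abs_of_nonneg (pow_nonneg (smoothTransition.nonneg t) n)]
      exact pow_le_one₀ (smoothTransition.nonneg t) (smoothTransition.le_one t))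
    intervalIntegrable_const
    (by
      filter_upwards [MeasureTheory.Measure.ae_ne MeasureTheory.volume (1 : ℝ)] with t ht hmem
      rw [Set.uIoc_of_le zero_le_one] at hmem
      exact tendsto_pow_atTop_nhds_zero_of_lt_one (smoothTransition.nonneg t)
        (smoothTransition.lt_one_of_lt_one (lt_of_le_of_ne hmem.2 ht)))
  simpa using h

end Real.smoothTransition

open Real in
theorem exists_contDiff_antitone_integral_eq {m : ℝ} (hm₀ : 0 < m) (hm₁ : m < 1) :
    ∃ ψ : ℝ → ℝ, ContDiff ℝ (⊤ : ℕ∞) ψ ∧ Antitone ψ ∧ (∀ t ≤ 0, ψ t = 1) ∧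
      (∀ t, 1 ≤ t → ψ t = 0) ∧ (∀ t < 1, 0 < ψ t) ∧ ∫ t in (0 : ℝ)..1, ψ t = m := by
  obtain ⟨n, hn, hI₀, hI₁⟩ : ∃ n : ℕ, n ≠ 0 ∧ ∫ t in (0 : ℝ)..1, smoothTransition t ^ n < m ∧
      ∫ t in (0 : ℝ)..1, smoothTransition t ^ n < 1 - m :=
    ((eventually_ne_atTop 0).and
      ((smoothTransition.tendsto_integral_pow_zero.eventually_lt_const hm₀).and
        (smoothTransition.tendsto_integral_pow_zero.eventually_lt_const
          (sub_pos.2 hm₁)))).exists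
  set I := ∫ t in (0 : ℝ)..1, smoothTransition t ^ n with hI
  have hden : 0 < 1 - 2 * I := by linarith
  obtain ⟨s, hs₀, hs₁, hs⟩ : ∃ s : ℝ, 0 ≤ s ∧ s ≤ 1 ∧ s * I + (1 - s) * (1 - I) = m := by
    refine ⟨(1 - I - m) / (1 - 2 * I), div_nonneg (by linarith) hden.le,
      (div_le_one hden).2 (by linarith), ?_⟩
    linear_combination -div_mul_cancel₀ (1 - I - m) hden.ne'
  have hrefl : ∫ t in (0 : ℝ)..1, smoothTransition (1 - t) ^ n = I := by
    simpa using intervalIntegral.integral_comp_sub_left (a := 0) (b := 1)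
      (fun t ↦ smoothTransition t ^ n) 1
  have hc : Continuous fun t ↦ smoothTransition t ^ n := smoothTransition.continuous.pow n
  have hc' : Continuous fun t ↦ smoothTransition (1 - t) ^ n :=
    hc.comp (continuous_const.sub continuous_id)
  refine ⟨fun t ↦ s * smoothTransition (1 - t) ^ n + (1 - s) * (1 - smoothTransition t ^ n),
    ?_, ?_, ?_, ?_, ?_, ?_⟩
  · have h : ContDiff ℝ (⊤ : ℕ∞) smoothTransition := smoothTransition.contDiff
    have h' : ContDiff ℝ (⊤ : ℕ∞) fun t : ℝ ↦ smoothTransition (1 - t) :=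
      h.comp (contDiff_const.sub contDiff_id)
    exact (contDiff_const.mul (h'.pow n)).add
      (contDiff_const.mul (contDiff_const.sub (h.pow n)))
  · intro x y hxy
    have hs' : 0 ≤ 1 - s := sub_nonneg.2 hs₁
    have h₁ : smoothTransition (1 - y) ^ n ≤ smoothTransition (1 - x) ^ n :=
      pow_le_pow_left₀ (smoothTransition.nonneg _)
        (smoothTransition.monotone (by linarith)) n
    have h₂ : smoothTransition x ^ n ≤ smoothTransition y ^ n :=
      pow_le_pow_left₀ (smoothTransition.nonneg _) (smoothTransition.monotone hxy) n
    dsimp only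
    gcongr
  · intro t ht
    simp [smoothTransition.zero_of_nonpos ht,
      smoothTransition.one_of_one_le (show 1 ≤ 1 - t by linarith), hn]
  · intro t ht
    simp [smoothTransition.one_of_one_le ht,
      smoothTransition.zero_of_nonpos (show 1 - t ≤ 0 by linarith), hn]
  · intro t ht
    have h₁ : 0 < smoothTransition (1 - t) ^ n :=
      pow_pos (smoothTransition.pos_of_pos (by linarith)) n
    have h₂ : 0 < 1 - smoothTransition t ^ n :=
      sub_pos.2 (pow_lt_one₀ (smoothTransition.nonneg t)
        (smoothTransition.lt_one_of_lt_one ht) hn)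
    rcases hs₀.eq_or_lt with rfl | hs₀
    · simpa using h₂
    · exact add_pos_of_pos_of_nonneg (mul_pos hs₀ h₁)
        (mul_nonneg (sub_nonneg.2 hs₁) h₂.le)
  · have hi : IntervalIntegrable (fun t ↦ s * smoothTransition (1 - t) ^ n)
        MeasureTheory.volume 0 1 := (continuous_const.mul hc').intervalIntegrable _ _
    have hi' : IntervalIntegrable (fun t ↦ (1 - s) * (1 - smoothTransition t ^ n))
        MeasureTheory.volume 0 1 :=
      (continuous_const.mul (continuous_const.sub hc)).intervalIntegrable _ _
    rw [intervalIntegral.integral_add hi hi',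
      intervalIntegral.integral_const_mul, intervalIntegral.integral_const_mul,
      intervalIntegral.integral_sub intervalIntegrable_const (hc.intervalIntegrable _ _), hrefl,
      ← hI]
    simpa using hs

/-- A concave function tangent to a line of positive slope at the left end of an interval and
stationary at the right end stays strictly below that line at the right end. -/
theorem ConcaveOn.sub_lt_mul_of_hasDerivAt {g : ℝ → ℝ} {a b α : ℝ} (hab : a < b) (hα : 0 < α)
    (hg : ConcaveOn ℝ (Set.Icc a b) g) (ha : HasDerivAt g α a) (hb : HasDerivAt g 0 b) :
    g b - g a < (b - a) * α := by
  by_contra! hle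
  have hmem_a : a ∈ Set.Icc a b := Set.left_mem_Icc.2 hab.le
  have hbelow (r : ℝ) (hr : r ∈ Set.Ioc a b) : g r - g a ≤ (r - a) * α := by
    have h := hg.slope_le_of_hasDerivAt hmem_a ⟨hr.1.le, hr.2⟩ hr.1 ha
    rwa [slope_def_field, div_le_iff₀ (sub_pos.2 hr.1), mul_comm] at h
  have hmax : IsMaxOn (fun r ↦ g r - r * α) (Set.Ioc a b) b := fun r hr ↦ by
    have := hbelow r hr
    simp only [Set.mem_ofPred_eq]
    linarith
  have hd : HasDerivAt (fun r ↦ g r - r * α) (-α) b := by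
    simpa using hb.fun_sub ((hasDerivAt_id b).mul_const α)
  have hlt : ∀ᶠ r in 𝓝[<] b, slope (fun r ↦ g r - r * α) b r < 0 :=
    ((hasDerivAt_iff_tendsto_slope.1 hd).mono_left
      (nhdsWithin_mono _ fun r hr ↦ ne_of_lt hr)).eventually_lt_const (neg_lt_zero.2 hα)
  obtain ⟨r, hr, hr'⟩ := (hlt.and (Ioo_mem_nhdsLT hab)).exists
  have h := hmax ⟨hr'.1, hr'.2.le⟩
  simp only [Set.mem_ofPred_eq] at h
  rw [slope_def_field] at hr
  exact hr.not_ge (div_nonneg_of_nonpos (by linarith) (by linarith [hr'.2]))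

theorem exists_concave_smooth_interpolation {r₀ β₀ β₁ ℓ α : ℝ} (hℓ : 0 < ℓ) (hα : 0 < α)
    (h₀ : 0 < β₁ - β₀ - α * r₀) (h₁ : β₁ - β₀ - α * r₀ < ℓ * α) :
    ∃ g : ℝ → ℝ, ContDiff ℝ (⊤ : ℕ∞) g ∧
      (∀ r ≤ r₀, g r = α * r + β₀) ∧
      (∀ r, r₀ + ℓ ≤ r → g r = β₁) ∧
      ConcaveOn ℝ (Set.Icc r₀ (r₀ + ℓ)) g ∧
      StrictMonoOn g (Set.Icc r₀ (r₀ + ℓ)) := by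
  have hℓα : 0 < ℓ * α := mul_pos hℓ hα
  obtain ⟨ψ, hsmooth, hanti, hψ₀, hψ₁, hpos, hint⟩ :=
    exists_contDiff_antitone_integral_eq (div_pos h₀ hℓα) ((div_lt_one hℓα).2 h₁)
  have hψc := hsmooth.continuous
  set g : ℝ → ℝ := fun r ↦ α * r₀ + β₀ + ℓ * α * ∫ t in (0 : ℝ)..(r - r₀) / ℓ, ψ t with hg
  have hderiv (r : ℝ) : HasDerivAt g (α * ψ ((r - r₀) / ℓ)) r := by
    have hG : HasDerivAt (fun u ↦ ∫ t in (0 : ℝ)..u, ψ t) (ψ ((r - r₀) / ℓ)) ((r - r₀) / ℓ) :=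
      intervalIntegral.integral_hasDerivAt_right (hψc.intervalIntegrable _ _)
        (hψc.stronglyMeasurableAtFilter _ _) hψc.continuousAt
    have hu : HasDerivAt (fun r : ℝ ↦ (r - r₀) / ℓ) (1 / ℓ) r :=
      ((hasDerivAt_id r).sub_const r₀).div_const ℓ
    refine (((hG.comp r hu).const_mul (ℓ * α)).const_add (α * r₀ + β₀)).congr_deriv ?_
    field_simp
  have hdiff : Differentiable ℝ g := fun r ↦ (hderiv r).differentiableAt
  have hderiv_eq : deriv g = fun r ↦ α * ψ ((r - r₀) / ℓ) := funext fun r ↦ (hderiv r).deriv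
  refine ⟨g, ?_, ?_, ?_, ?_, ?_⟩
  · refine contDiff_infty_iff_deriv.2 ⟨hdiff, ?_⟩
    rw [hderiv_eq]
    exact contDiff_const.mul
      (hsmooth.comp ((contDiff_id.sub contDiff_const).div_const ℓ))
  · intro r hr
    have hu : (r - r₀) / ℓ ≤ 0 := div_nonpos_of_nonpos_of_nonneg (by linarith) hℓ.le
    have hcongr : ∫ t in (0 : ℝ)..(r - r₀) / ℓ, ψ t = ∫ _ in (0 : ℝ)..(r - r₀) / ℓ, (1 : ℝ) :=
      intervalIntegral.integral_congr fun t ht ↦ by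
        rw [Set.uIcc_of_ge hu] at ht
        exact hψ₀ t ht.2
    simp only [hg, hcongr, intervalIntegral.integral_const, smul_eq_mul]
    field_simp
    ring
  · intro r hr
    have hu : 1 ≤ (r - r₀) / ℓ := (one_le_div hℓ).2 (by linarith)
    have hcongr : ∫ t in (1 : ℝ)..(r - r₀) / ℓ, ψ t = ∫ _ in (1 : ℝ)..(r - r₀) / ℓ, (0 : ℝ) :=
      intervalIntegral.integral_congr fun t ht ↦ by
        rw [Set.uIcc_of_le hu] at ht
        exact hψ₁ t ht.1
    simp only [hg]
    rw [← intervalIntegral.integral_add_adjacent_intervals (hψc.intervalIntegrable 0 1)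
      (hψc.intervalIntegrable 1 _), hint, hcongr, intervalIntegral.integral_zero, add_zero,
      mul_div_cancel₀ _ hℓα.ne']
    ring
  · refine (Antitone.concaveOn_univ_of_deriv hdiff ?_).subset (Set.subset_univ _)
      (convex_Icc _ _)
    rw [hderiv_eq]
    intro x y hxy
    exact mul_le_mul_of_nonneg_left (hanti (by gcongr)) hα.le
  · refine strictMonoOn_of_deriv_pos (convex_Icc _ _) hdiff.continuous.continuousOn
      fun r hr ↦ ?_
    rw [interior_Icc] at hr
    rw [hderiv_eq]
    exact mul_pos hα (hpos _ ((div_lt_one hℓ).2 (by linarith [hr.2])))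

/-- Lemma A.2: existence of a concave, strictly increasing smooth interpolation
between the affine function `α·r + β₀` and the constant `β₁` iff
`0 < β₁ − β₀ − α·r₀ < ℓ·α`. -/
theorem stmt_1 (r₀ β₀ β₁ ℓ α : ℝ) (hℓ : 0 < ℓ) (hα : 0 < α) :
    (∃ g : ℝ → ℝ, ContDiff ℝ (⊤ : ℕ∞) g ∧
      (∀ r ≤ r₀, g r = α * r + β₀) ∧
      (∀ r, r₀ + ℓ ≤ r → g r = β₁) ∧
      ConcaveOn ℝ (Set.Icc r₀ (r₀ + ℓ)) g ∧
      StrictMonoOn g (Set.Icc r₀ (r₀ + ℓ)))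
    ↔ (0 < β₁ - β₀ - α * r₀ ∧ β₁ - β₀ - α * r₀ < ℓ * α) := by
  refine ⟨?_, fun h ↦ exists_concave_smooth_interpolation hℓ hα h.1 h.2⟩
  rintro ⟨g, hsmooth, hleft, hright, hconc, hmono⟩
  have hab : r₀ < r₀ + ℓ := by linarith
  have hdiff : Differentiable ℝ g := hsmooth.differentiable (by simp)
  have ha : HasDerivAt g α r₀ := by
    have h₁ : HasDerivWithinAt g α (Set.Iic r₀) r₀ := by
      have h : HasDerivAt (fun r ↦ α * r + β₀) α r₀ := by
        simpa using ((hasDerivAt_id r₀).const_mul α).add_const β₀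
      exact h.hasDerivWithinAt.congr hleft (hleft r₀ le_rfl)
    have h₂ := (hdiff r₀).hasDerivAt
    rwa [(uniqueDiffWithinAt_Iic r₀).eq_deriv _ h₂.hasDerivWithinAt h₁] at h₂
  have hb : HasDerivAt g 0 (r₀ + ℓ) := by
    have h₁ : HasDerivWithinAt g 0 (Set.Ici (r₀ + ℓ)) (r₀ + ℓ) :=
      (hasDerivWithinAt_const _ _ β₁).congr hright (hright _ le_rfl)
    have h₂ := (hdiff (r₀ + ℓ)).hasDerivAt
    rwa [(uniqueDiffWithinAt_Ici (r₀ + ℓ)).eq_deriv _ h₂.hasDerivWithinAt h₁] at h₂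
  have hlt := hmono (Set.left_mem_Icc.2 hab.le) (Set.right_mem_Icc.2 hab.le) hab
  have hub := hconc.sub_lt_mul_of_hasDerivAt hab hα ha hb
  rw [hleft r₀ le_rfl, hright _ le_rfl] at hlt hub
  exact ⟨by linarith, by linarith⟩
end
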